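/- Let A_1,…,A_s be real l×m matrices, c ∈ ℝ^m, R a real n×s matrix, and b ∈ ℝ^n. Define the feasible set F of all tuples (w, μ, (h_i)_{i∈[s]}) with w ∈ ℝ^s, w ≥ 0, μ ∈ ℝ^s, μ ≥ 0, h_i ∈ ℝ^l, satisfying Σ_{i=1}^s A_i^T h_i = c, R w ≤ b (componentwise), and ‖h_i‖² ≤ μ_i w_i for all i. Then: (1) F is nonempty if and only if there exists w ∈ ℝ^s with w ≥ 0, R w ≤ b, and c in the range of M(w); (2) if (w*, μ*, (h_i*)) minimizes Σ_{i=1}^s μ_i over F, then w* minimizes V_c over the set {w ∈ ℝ^s : w ≥ 0, R w ≤ b, c in the range of M(w)}, and the minimal value of V_c on this set equals Σ_{i=1}^s μ_i*. -/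

import Mathlib

open Matrix BigOperators

/-- Euclidean norm on `Fin n → ℝ`. -/
noncomputable def euclNorm {n : ℕ} (v : Fin n → ℝ) : ℝ :=
  Real.sqrt (∑ i, v i ^ 2)

/-- Information matrix `M(w) = ∑ i, w i • A iᵀ A i` for multiresponse experiments. -/
noncomputable def infoMat {s l m : ℕ} (A : Fin s → Matrix (Fin l) (Fin m) ℝ)
    (w : Fin s → ℝ) : Matrix (Fin m) (Fin m) ℝ :=
  ∑ i, w i • ((A i)ᵀ * A i)

/-- Feasible set of the SOCP with multiple resource constraints:
`w ≥ 0`, `μ ≥ 0`, `∑ i, A iᵀ h i = c`, `R w ≤ b`, and `‖h i‖² ≤ μ i * w i`. -/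
def SOCPFeas {s l m n : ℕ} (A : Fin s → Matrix (Fin l) (Fin m) ℝ) (c : Fin m → ℝ)
    (R : Matrix (Fin n) (Fin s) ℝ) (b : Fin n → ℝ)
    (w μ : Fin s → ℝ) (h : Fin s → Fin l → ℝ) : Prop :=
  (∀ i, 0 ≤ w i) ∧ (∀ i, 0 ≤ μ i) ∧
  (∑ i, (A i)ᵀ *ᵥ h i = c) ∧
  (∀ j, (R *ᵥ w) j ≤ b j) ∧
  (∀ i, euclNorm (h i) ^ 2 ≤ μ i * w i)

theorem euclNorm_sq {n : ℕ} (v : Fin n → ℝ) : euclNorm v ^ 2 = v ⬝ᵥ v := by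
  rw [euclNorm, Real.sq_sqrt (Finset.sum_nonneg fun i _ => sq_nonneg _)]
  simp only [dotProduct, sq]

theorem dotProduct_self_nonneg_real {n : ℕ} (v : Fin n → ℝ) : 0 ≤ v ⬝ᵥ v := by
  rw [← euclNorm_sq]
  exact sq_nonneg _

theorem infoMat_transpose {s l m : ℕ} (A : Fin s → Matrix (Fin l) (Fin m) ℝ)
    (w : Fin s → ℝ) : (infoMat A w)ᵀ = infoMat A w := by
  simp [infoMat, Matrix.transpose_sum, Matrix.transpose_mul]

theorem infoMat_mulVec {s l m : ℕ} (A : Fin s → Matrix (Fin l) (Fin m) ℝ)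
    (w : Fin s → ℝ) (u : Fin m → ℝ) :
    infoMat A w *ᵥ u = ∑ i, (A i)ᵀ *ᵥ (w i • (A i *ᵥ u)) := by
  simp [infoMat, Matrix.sum_mulVec, Matrix.smul_mulVec, Matrix.mulVec_smul]

theorem sum_transpose_mulVec_dotProduct {s l m : ℕ} (A : Fin s → Matrix (Fin l) (Fin m) ℝ)
    (h : Fin s → Fin l → ℝ) (u : Fin m → ℝ) :
    (∑ i, (A i)ᵀ *ᵥ h i) ⬝ᵥ u = ∑ i, h i ⬝ᵥ (A i *ᵥ u) := by
  simp [sum_dotProduct, Matrix.mulVec_transpose, Matrix.dotProduct_mulVec]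

theorem infoMat_mulVec_dotProduct {s l m : ℕ} (A : Fin s → Matrix (Fin l) (Fin m) ℝ)
    (w : Fin s → ℝ) (u : Fin m → ℝ) :
    (infoMat A w *ᵥ u) ⬝ᵥ u = ∑ i, w i * ((A i *ᵥ u) ⬝ᵥ (A i *ᵥ u)) := by
  rw [infoMat_mulVec, sum_transpose_mulVec_dotProduct]
  simp

/-- A vector orthogonal to the kernel of a symmetric matrix lies in its range. -/
theorem exists_mulVec_eq_of_forall_ker {m : ℕ} (M : Matrix (Fin m) (Fin m) ℝ) (hM : Mᵀ = M)
    (c : Fin m → ℝ) (hc : ∀ x, M *ᵥ x = 0 → c ⬝ᵥ x = 0) : ∃ u, M *ᵥ u = c := by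
  by_contra hne
  have hmem : c ∉ LinearMap.range M.mulVecLin := fun ⟨u, hu⟩ => hne ⟨u, by simpa using hu⟩
  obtain ⟨f, hfc, hf⟩ := Submodule.exists_le_ker_of_notMem hmem
  obtain ⟨x, rfl⟩ := (dotProductEquiv ℝ (Fin m)).surjective f
  refine hfc ?_
  rw [dotProductEquiv_apply_apply, dotProduct_comm]
  refine hc x (dotProduct_eq_zero _ fun u => ?_)
  have hu : x ⬝ᵥ (M *ᵥ u) = 0 := hf ⟨u, rfl⟩
  rwa [Matrix.dotProduct_mulVec, ← Matrix.mulVec_transpose, hM] at hu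

/-- Cauchy–Schwarz followed by the inequality of arithmetic and geometric means. -/
theorem two_mul_dotProduct_le {l : ℕ} {h a : Fin l → ℝ} {w μ : ℝ} (hw : 0 ≤ w) (hμ : 0 ≤ μ)
    (hh : euclNorm h ^ 2 ≤ μ * w) : 2 * (h ⬝ᵥ a) ≤ μ + w * (a ⬝ᵥ a) := by
  rw [euclNorm_sq] at hh
  rcases hw.eq_or_lt with rfl | hw
  · have h0 : h = 0 :=
      dotProduct_self_eq_zero.1 (le_antisymm (by simpa using hh) (dotProduct_self_nonneg_real h))
    simpa [h0] using hμ
  · have hsq := dotProduct_self_nonneg_real (h - w • a)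
    simp only [sub_dotProduct, dotProduct_sub, smul_dotProduct, dotProduct_smul, smul_eq_mul,
      dotProduct_comm a h] at hsq
    refine le_of_mul_le_mul_left ?_ hw
    nlinarith

theorem SOCPFeas.exists_infoMat_mulVec_eq {s l m n : ℕ} {A : Fin s → Matrix (Fin l) (Fin m) ℝ}
    {c : Fin m → ℝ} {R : Matrix (Fin n) (Fin s) ℝ} {b : Fin n → ℝ} {w μ : Fin s → ℝ}
    {h : Fin s → Fin l → ℝ} (H : SOCPFeas A c R b w μ h) : ∃ u, infoMat A w *ᵥ u = c := by
  obtain ⟨hw, -, hc, -, hh⟩ := H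
  refine exists_mulVec_eq_of_forall_ker _ (infoMat_transpose A w) c fun x hx => ?_
  have hsum := infoMat_mulVec_dotProduct A w x
  rw [hx, zero_dotProduct, eq_comm, Finset.sum_eq_zero_iff_of_nonneg
    fun i _ => mul_nonneg (hw i) (dotProduct_self_nonneg_real _)] at hsum
  rw [← hc, sum_transpose_mulVec_dotProduct]
  refine Finset.sum_eq_zero fun i hi => ?_
  rcases mul_eq_zero.1 (hsum i hi) with h0 | h0
  · have hle := hh i
    rw [h0, mul_zero, euclNorm_sq] at hle
    rw [dotProduct_self_eq_zero.1 (le_antisymm hle (dotProduct_self_nonneg_real _)),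
      zero_dotProduct]
  · rw [dotProduct_self_eq_zero.1 h0, dotProduct_zero]

theorem SOCPFeas.dotProduct_le {s l m n : ℕ} {A : Fin s → Matrix (Fin l) (Fin m) ℝ}
    {c : Fin m → ℝ} {R : Matrix (Fin n) (Fin s) ℝ} {b : Fin n → ℝ} {w μ : Fin s → ℝ}
    {h : Fin s → Fin l → ℝ} (H : SOCPFeas A c R b w μ h) {u : Fin m → ℝ}
    (hu : infoMat A w *ᵥ u = c) : c ⬝ᵥ u ≤ ∑ i, μ i := by
  obtain ⟨hw, hμ, hc, -, hh⟩ := H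
  have hle := Finset.sum_le_sum fun i (_ : i ∈ Finset.univ) =>
    two_mul_dotProduct_le (a := A i *ᵥ u) (hw i) (hμ i) (hh i)
  rw [← Finset.mul_sum, ← sum_transpose_mulVec_dotProduct, hc, Finset.sum_add_distrib,
    ← infoMat_mulVec_dotProduct, hu] at hle
  linarith

/-- A feasible design for which `c` is estimable gives a feasible point of the SOCP. -/
theorem SOCPFeas.of_infoMat_mulVec_eq {s l m n : ℕ} {A : Fin s → Matrix (Fin l) (Fin m) ℝ}
    {c : Fin m → ℝ} {R : Matrix (Fin n) (Fin s) ℝ} {b : Fin n → ℝ} {w : Fin s → ℝ}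
    {u : Fin m → ℝ} (hw : ∀ i, 0 ≤ w i) (hR : ∀ j, (R *ᵥ w) j ≤ b j)
    (hu : infoMat A w *ᵥ u = c) :
    SOCPFeas A c R b w (fun i => w i * ((A i *ᵥ u) ⬝ᵥ (A i *ᵥ u)))
      (fun i => w i • (A i *ᵥ u)) := by
  refine ⟨hw, fun i => mul_nonneg (hw i) (dotProduct_self_nonneg_real _), ?_, hR, fun i => ?_⟩
  · rw [← infoMat_mulVec, hu]
  · rw [euclNorm_sq, smul_dotProduct, dotProduct_smul, smul_eq_mul, smul_eq_mul]
    exact le_of_eq (by ring)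

/-- **`c`-optimal designs with multiple resource constraints.** The SOCP is feasible iff
`cᵀθ` is estimable for a feasible design, and any SOCP solution yields a `c`-optimal design
(for the problem constrained by `R w ≤ b`) whose minimal variance is `∑ μ*ᵢ`. -/
theorem cOptimal_multiconstraints {s l m n : ℕ}
    (A : Fin s → Matrix (Fin l) (Fin m) ℝ) (c : Fin m → ℝ)
    (R : Matrix (Fin n) (Fin s) ℝ) (b : Fin n → ℝ) :
    ((∃ w μ h, SOCPFeas A c R b w μ h) ↔
      ∃ w : Fin s → ℝ, (∀ i, 0 ≤ w i) ∧ (∀ j, (R *ᵥ w) j ≤ b j) ∧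
        ∃ u, infoMat A w *ᵥ u = c) ∧
    (∀ (wstar μstar : Fin s → ℝ) (hstar : Fin s → Fin l → ℝ),
      SOCPFeas A c R b wstar μstar hstar →
      (∀ w μ h, SOCPFeas A c R b w μ h → ∑ i, μstar i ≤ ∑ i, μ i) →
      ((∀ i, 0 ≤ wstar i) ∧ (∀ j, (R *ᵥ wstar) j ≤ b j) ∧
        (∃ u, infoMat A wstar *ᵥ u = c)) ∧
      (∀ u, infoMat A wstar *ᵥ u = c → c ⬝ᵥ u = ∑ i, μstar i) ∧
      (∀ (w : Fin s → ℝ) (u : Fin m → ℝ), (∀ i, 0 ≤ w i) →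
        (∀ j, (R *ᵥ w) j ≤ b j) → infoMat A w *ᵥ u = c →
        ∑ i, μstar i ≤ c ⬝ᵥ u)) := by
  refine ⟨⟨?_, ?_⟩, fun wstar μstar hstar H hmin => ?_⟩
  · rintro ⟨w, μ, h, H⟩
    exact ⟨w, H.1, H.2.2.2.1, H.exists_infoMat_mulVec_eq⟩
  · rintro ⟨w, hw, hR, u, hu⟩
    exact ⟨_, _, _, SOCPFeas.of_infoMat_mulVec_eq hw hR hu⟩
  · have hlb : ∀ (w : Fin s → ℝ) (u : Fin m → ℝ), (∀ i, 0 ≤ w i) →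
        (∀ j, (R *ᵥ w) j ≤ b j) → infoMat A w *ᵥ u = c → ∑ i, μstar i ≤ c ⬝ᵥ u := by
      intro w u hw hR hu
      have hle := hmin _ _ _ (SOCPFeas.of_infoMat_mulVec_eq hw hR hu)
      rwa [← infoMat_mulVec_dotProduct, hu] at hle
    exact ⟨⟨H.1, H.2.2.2.1, H.exists_infoMat_mulVec_eq⟩,
      fun u hu => le_antisymm (H.dotProduct_le hu) (hlb wstar u H.1 H.2.2.2.1 hu), hlb⟩
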